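/- arXiv:1805.01320 — 12 statements merged into one kernel-verified Lean document; each statement's English description precedes it below -/
import Mathlib

section
/- Fix α > 0 and δ ≥ 0, and let Ψα be a real number. Let x_α be a minimizer of T_α(·; y) and let ξ_α be a subgradient of J at x_α satisfying the optimality condition for (α, y). Let y_δ ∈ H with ‖y_δ − y‖ ≤ δ, let x_αδ be a minimizer of T_α(·; y_δ), and let ξ_αδ be a subgradient of J at x_αδ satisfying the optimality condition for (α, y_δ). If (1/α)·(T_α(x†; y) − T_α(x_α; y)) ≤ Ψα (defect for the Tikhonov functional), then B_{ξ_αδ}(x_αδ; x†) ≤ δ²/(2α) + Ψα. -/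
open RealInnerProductSpace

/-- Under the defect-for-Tikhonov-functional condition at level `Ψα`,
the Bregman distance `B_{ξ_αδ}(x_αδ; x†)` is bounded by `δ²/(2α) + Ψα`. -/
theorem stmt_0
    {X H : Type*} [NormedAddCommGroup X] [NormedSpace ℝ X]
    [NormedAddCommGroup H] [InnerProductSpace ℝ H]
    (A : X →L[ℝ] H) (J : X → ℝ)
    (hJconv : ConvexOn ℝ Set.univ J) (hJnonneg : ∀ x, 0 ≤ J x)
    (T : ℝ → H → X → ℝ)
    (hT : ∀ α v x, T α v x = (1/2) * ‖A x - v‖^2 + α * J x)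
    (xdag : X) (y : H) (hy : y = A xdag)
    (α δ : ℝ) (hα : 0 < α) (hδ : 0 ≤ δ) (Ψα : ℝ)
    (xα : X) (hxα : ∀ x, T α y xα ≤ T α y x)
    (ξα : X →L[ℝ] ℝ)
    (hξα_sub : ∀ x, J xα + ξα (x - xα) ≤ J x)
    (hξα_opt : ∀ w, ⟪A xα - y, A w⟫ + α * ξα w = 0)
    (yδ : H) (hyδ : ‖yδ - y‖ ≤ δ)
    (xαδ : X) (hxαδ : ∀ x, T α yδ xαδ ≤ T α yδ x)
    (ξαδ : X →L[ℝ] ℝ)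
    (hξαδ_sub : ∀ x, J xαδ + ξαδ (x - xαδ) ≤ J x)
    (hξαδ_opt : ∀ w, ⟪A xαδ - yδ, A w⟫ + α * ξαδ w = 0)
    (hdefect : (1/α) * (T α y xdag - T α y xα) ≤ Ψα) :
    J xdag - J xαδ - ξαδ (xdag - xαδ) ≤ δ^2 / (2*α) + Ψα := by
  have h_opt := hξαδ_opt (xdag - xαδ)
  have h_min := hxα xαδ
  have h_split : A xαδ - yδ = (A xαδ - y) - (yδ - y) := by abel
  have h_dir : A (xdag - xαδ) = -(A xαδ - y) := by rw [map_sub, hy]; abel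
  rw [h_split, h_dir, inner_neg_right, inner_sub_left, real_inner_self_eq_norm_sq] at h_opt
  have h_dag : T α y xdag = α * J xdag := by simp [hT, hy]
  rw [one_div, inv_mul_le_iff₀ hα, h_dag] at hdefect
  rw [hT α y xαδ] at h_min
  have h_young := norm_sub_sq_real (yδ - y) (A xαδ - y)
  have h_sq : ‖yδ - y‖ ^ 2 ≤ δ ^ 2 := by gcongr
  have h_rhs : δ ^ 2 / (2 * α) + Ψα = (δ ^ 2 / 2 + α * Ψα) / α := by
    field_simp
  rw [h_rhs, le_div_iff₀ hα]
  linarith [sq_nonneg ‖yδ - y - (A xαδ - y)‖]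
end

section
/- Fix α > 0 and δ ≥ 0, and let Ψα be a real number. Let x_α be a minimizer of T_α(·; y) and let ξ_α be a subgradient of J at x_α satisfying the optimality condition for (α, y). Let y_δ ∈ H with ‖y_δ − y‖ ≤ δ, let x_αδ be a minimizer of T_α(·; y_δ), and let ξ_αδ be a subgradient of J at x_αδ satisfying the optimality condition for (α, y_δ). If J(x†) − J(x_α) ≤ Ψα (defect for the penalty), then B_{ξ_αδ}(x_αδ; x†) ≤ δ²/(2α) + Ψα. -/
open RealInnerProductSpace

/-- Under the defect-for-penalty condition at level `Ψα`,
the Bregman distance `B_{ξ_αδ}(x_αδ; x†)` is bounded by `δ²/(2α) + Ψα`. -/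
theorem stmt_1
    {X H : Type*} [NormedAddCommGroup X] [NormedSpace ℝ X]
    [NormedAddCommGroup H] [InnerProductSpace ℝ H]
    (A : X →L[ℝ] H) (J : X → ℝ)
    (hJconv : ConvexOn ℝ Set.univ J) (hJnonneg : ∀ x, 0 ≤ J x)
    (T : ℝ → H → X → ℝ)
    (hT : ∀ α v x, T α v x = (1/2) * ‖A x - v‖^2 + α * J x)
    (xdag : X) (y : H) (hy : y = A xdag)
    (α δ : ℝ) (hα : 0 < α) (hδ : 0 ≤ δ) (Ψα : ℝ)
    (xα : X) (hxα : ∀ x, T α y xα ≤ T α y x)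
    (ξα : X →L[ℝ] ℝ)
    (hξα_sub : ∀ x, J xα + ξα (x - xα) ≤ J x)
    (hξα_opt : ∀ w, ⟪A xα - y, A w⟫ + α * ξα w = 0)
    (yδ : H) (hyδ : ‖yδ - y‖ ≤ δ)
    (xαδ : X) (hxαδ : ∀ x, T α yδ xαδ ≤ T α yδ x)
    (ξαδ : X →L[ℝ] ℝ)
    (hξαδ_sub : ∀ x, J xαδ + ξαδ (x - xαδ) ≤ J x)
    (hξαδ_opt : ∀ w, ⟪A xαδ - yδ, A w⟫ + α * ξαδ w = 0)
    (hdefect : J xdag - J xα ≤ Ψα) :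
    J xdag - J xαδ - ξαδ (xdag - xαδ) ≤ δ^2 / (2*α) + Ψα := by
  have h_min := hxα xαδ
  rw [hT, hT] at h_min
  have h_opt := hξαδ_opt (xdag - xαδ)
  have h_res : A xαδ - yδ = (A xαδ - y) - (yδ - y) := by abel
  rw [map_sub, ← hy, h_res, ← neg_sub (A xαδ) y, inner_neg_right, inner_sub_left,
    real_inner_self_eq_norm_sq] at h_opt
  have h_inner := real_inner_le_norm (yδ - y) (A xαδ - y)
  have h_noise : ‖yδ - y‖ ^ 2 ≤ δ ^ 2 := pow_le_pow_left₀ (norm_nonneg _) hyδ 2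
  have h_defect := mul_le_mul_of_nonneg_left hdefect hα.le
  have h_scaled : α * (J xdag - J xαδ - ξαδ (xdag - xαδ)) ≤ δ ^ 2 / 2 + α * Ψα := by
    nlinarith [sq_nonneg (‖yδ - y‖ - ‖A xαδ - y‖), sq_nonneg ‖A xα - y‖]
  have h_rhs : α * (δ ^ 2 / (2 * α) + Ψα) = δ ^ 2 / 2 + α * Ψα := by
    field_simp
  exact le_of_mul_le_mul_left (h_scaled.trans_eq h_rhs.symm) hα
end

section
/- Fix α > 0 and let Ψα be a real number. Let x_α be a minimizer of T_α(·; y) and let ξ_α be a subgradient of J at x_α satisfying the optimality condition for (α, y). If (1/α)·(T_α(x†; y) − T_α(x_α; y)) ≤ Ψα, then J(x†) − J(x_α) ≤ 2·Ψα. -/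
open RealInnerProductSpace

/-- the defect for the Tikhonov functional bounded by `Ψα` implies
the defect for the penalty is bounded by `2·Ψα`. -/
theorem stmt_2
    {X H : Type*} [NormedAddCommGroup X] [NormedSpace ℝ X]
    [NormedAddCommGroup H] [InnerProductSpace ℝ H]
    (A : X →L[ℝ] H) (J : X → ℝ)
    (hJconv : ConvexOn ℝ Set.univ J) (hJnonneg : ∀ x, 0 ≤ J x)
    (T : ℝ → H → X → ℝ)
    (hT : ∀ α v x, T α v x = (1/2) * ‖A x - v‖^2 + α * J x)
    (xdag : X) (y : H) (hy : y = A xdag)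
    (α : ℝ) (hα : 0 < α) (Ψα : ℝ)
    (xα : X) (hxα : ∀ x, T α y xα ≤ T α y x)
    (ξα : X →L[ℝ] ℝ)
    (hξα_sub : ∀ x, J xα + ξα (x - xα) ≤ J x)
    (hξα_opt : ∀ w, ⟪A xα - y, A w⟫ + α * ξα w = 0)
    (hdefect : (1/α) * (T α y xdag - T α y xα) ≤ Ψα) :
    J xdag - J xα ≤ 2 * Ψα := by
  subst hy
  have hopt := hξα_opt (xdag - xα)
  have hinner : ⟪A xα - A xdag, A (xdag - xα)⟫ = -‖A xα - A xdag‖ ^ 2 := by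
    rw [map_sub, ← neg_sub (A xα) (A xdag), inner_neg_right, real_inner_self_eq_norm_sq]
  rw [hinner] at hopt
  have hsub := mul_le_mul_of_nonneg_left (hξα_sub xdag) hα.le
  rw [one_div, inv_mul_le_iff₀ hα, hT, hT, sub_self, norm_zero] at hdefect
  refine le_of_mul_le_mul_left ?_ hα
  linarith
end

section
/- Suppose that for every α > 0 there are an element x_α minimizing T_α(·; y) and a subgradient ξ_α of J at x_α satisfying the optimality condition for (α, y). Suppose the sublevel set {x ∈ X : J(x) ≤ J(x†)} is bounded in norm. Let Ψ be an index function with J(x†) − J(x_α) ≤ Ψ(α) for every α > 0, and suppose there exists a sequence (α_k) of positive numbers with α_k → 0 and Ψ(α_k)/α_k → 0 as k → ∞. Then J(x†) ≤ J(x) for every x ∈ X, i.e. x† is a global minimizer of J. (Consequently, if J(x†) > inf_X J, then the bound Ψ in the defect-for-penalty condition can increase near zero at most linearly.) -/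
open RealInnerProductSpace Filter

/-- A quantitative form: the defect of `J` below `J z`, where `z` is the exact solution, is controlled
by the penalty defect `p` and by the dual bound `√(p / a)` on the subgradient. -/
lemma le_add_of_optimality
    {X H : Type*} [NormedAddCommGroup X] [NormedSpace ℝ X]
    [NormedAddCommGroup H] [InnerProductSpace ℝ H]
    (A : X →L[ℝ] H) (J : X → ℝ) (z u : X) (ζ : X →L[ℝ] ℝ) {a p R : ℝ} (ha : 0 < a)
    (hsub : ∀ x, J u + ζ (x - u) ≤ J x)
    (hopt : ∀ w, ⟪A u - A z, A w⟫ + a * ζ w = 0)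
    (hdefect : J z - J u ≤ p) (hu : ‖u‖ ≤ R) (x : X) :
    J z ≤ J x + (p + √(p / a) * (‖A‖ * (‖x‖ + R))) := by
  have hnorm : ‖A u - A z‖ ^ 2 ≤ a * p := by
    have h1 := hopt (u - z)
    have h2 := hsub z
    rw [map_sub, real_inner_self_eq_norm_sq] at h1
    have h3 : ζ (z - u) = -ζ (u - z) := by rw [← map_neg, neg_sub]
    have h4 : a * (-ζ (u - z)) ≤ a * p := mul_le_mul_of_nonneg_left (by linarith) ha.le
    linarith
  have hdual : ‖A u - A z‖ / a ≤ √(p / a) := by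
    apply Real.le_sqrt_of_sq_le
    rw [div_pow, div_le_div_iff₀ (by positivity) ha]
    nlinarith
  have hA : ‖A (x - u)‖ ≤ ‖A‖ * (‖x‖ + R) :=
    (A.le_opNorm _).trans <| mul_le_mul_of_nonneg_left
      ((norm_sub_le x u).trans (by linarith)) (norm_nonneg A)
  have hζ : -ζ (x - u) ≤ √(p / a) * (‖A‖ * (‖x‖ + R)) := by
    have h1 : -ζ (x - u) = ⟪A u - A z, A (x - u)⟫ / a := by
      rw [eq_div_iff ha.ne']
      linarith [hopt (x - u)]
    calc -ζ (x - u) = ⟪A u - A z, A (x - u)⟫ / a := h1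
      _ ≤ ‖A u - A z‖ * ‖A (x - u)‖ / a := by
        gcongr
        exact real_inner_le_norm _ _
      _ = ‖A u - A z‖ / a * ‖A (x - u)‖ := by ring
      _ ≤ √(p / a) * (‖A‖ * (‖x‖ + R)) :=
        mul_le_mul hdual hA (norm_nonneg _) (Real.sqrt_nonneg _)
  linarith [hsub x]

/-- if the defect-for-penalty bound `Ψ` decays super-linearly along some
sequence `α_k → 0`, and the sublevel set of `J` at height `J(x†)` is bounded, then `x†`
is a global minimizer of `J`. -/
theorem stmt_3
    {X H : Type*} [NormedAddCommGroup X] [NormedSpace ℝ X]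
    [NormedAddCommGroup H] [InnerProductSpace ℝ H]
    (A : X →L[ℝ] H) (J : X → ℝ)
    (hJconv : ConvexOn ℝ Set.univ J) (hJnonneg : ∀ x, 0 ≤ J x)
    (T : ℝ → H → X → ℝ)
    (hT : ∀ α v x, T α v x = (1/2) * ‖A x - v‖^2 + α * J x)
    (xdag : X) (y : H) (hy : y = A xdag)
    -- family of minimizers with subgradients satisfying the optimality condition
    (xa : ℝ → X) (ξ : ℝ → (X →L[ℝ] ℝ))
    (hmin : ∀ α > (0:ℝ), ∀ x, T α y (xa α) ≤ T α y x)
    (hsub : ∀ α > (0:ℝ), ∀ x, J (xa α) + (ξ α) (x - xa α) ≤ J x)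
    (hopt : ∀ α > (0:ℝ), ∀ w, ⟪A (xa α) - y, A w⟫ + α * (ξ α) w = 0)
    -- bounded sublevel set
    (hbounded : Bornology.IsBounded {x : X | J x ≤ J xdag})
    -- Ψ is an index function
    (Ψ : ℝ → ℝ)
    (hΨpos : ∀ t > (0:ℝ), 0 < Ψ t)
    (hΨmono : StrictMonoOn Ψ (Set.Ioi 0))
    (hΨcont : ContinuousOn Ψ (Set.Ioi 0))
    (hΨ0 : Tendsto Ψ (nhdsWithin 0 (Set.Ioi 0)) (nhds 0))
    -- defect for the penalty
    (hdefect : ∀ α > (0:ℝ), J xdag - J (xa α) ≤ Ψ α)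
    -- sequence α_k → 0 with Ψ(α_k)/α_k → 0
    (αk : ℕ → ℝ) (hαkpos : ∀ k, 0 < αk k)
    (hαk0 : Tendsto αk atTop (nhds 0))
    (hsuper : Tendsto (fun k => Ψ (αk k) / αk k) atTop (nhds 0)) :
    ∀ x : X, J xdag ≤ J x := by
  subst hy
  obtain ⟨R, hR⟩ := hbounded.exists_norm_le
  have hxa : ∀ a > (0 : ℝ), ‖xa a‖ ≤ R := fun a ha => hR _ <| by
    have h := hmin a ha xdag
    rw [hT, hT, sub_self, norm_zero] at h
    exact le_of_mul_le_mul_left (by nlinarith [sq_nonneg ‖A (xa a) - A xdag‖]) ha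
  intro x
  have hΨk : Tendsto (fun k => Ψ (αk k)) atTop (nhds 0) := by
    have h := hsuper.mul hαk0
    rw [mul_zero] at h
    exact h.congr fun k => div_mul_cancel₀ _ (hαkpos k).ne'
  have hlim : Tendsto (fun k => J x + (Ψ (αk k) +
      √(Ψ (αk k) / αk k) * (‖A‖ * (‖x‖ + R)))) atTop (nhds (J x)) := by
    simpa using (hΨk.add (hsuper.sqrt.mul_const (‖A‖ * (‖x‖ + R)))).const_add (J x)
  exact ge_of_tendsto' hlim fun k =>
    le_add_of_optimality A J xdag (xa (αk k)) (ξ (αk k)) (hαkpos k) (hsub _ (hαkpos k))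
      (hopt _ (hαkpos k)) (hdefect _ (hαkpos k)) (hxa _ (hαkpos k)) x
end

section
/- Let Φ : [0,∞) → [0,∞) be a function with Φ(0) = 0 and lim_{t→0⁺} Φ(t)/t = 0. If the variational inequality J(x†) − J(x) ≤ Φ(‖A x − A x†‖) holds for every x ∈ X, then J(x†) ≤ J(x) for every x ∈ X, i.e. x† is a global minimizer of J. (Consequently, if J(x†) > inf_X J, then any function Φ appearing in such a variational inequality increases near zero at most linearly.) -/
open Filter

/-- if a variational inequality holds with a function `Φ` that decays
super-linearly at `0` (i.e. `Φ(t)/t → 0` as `t → 0⁺`), then `x†` is a global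
minimizer of `J`. -/
theorem stmt_4
    {X H : Type*} [NormedAddCommGroup X] [NormedSpace ℝ X]
    [NormedAddCommGroup H] [InnerProductSpace ℝ H]
    (A : X →L[ℝ] H) (J : X → ℝ)
    (hJconv : ConvexOn ℝ Set.univ J) (hJnonneg : ∀ x, 0 ≤ J x)
    (xdag : X)
    (Φ : ℝ → ℝ) (hΦnonneg : ∀ t ≥ (0:ℝ), 0 ≤ Φ t) (hΦ0 : Φ 0 = 0)
    (hΦsuper : Tendsto (fun t => Φ t / t) (nhdsWithin 0 (Set.Ioi 0)) (nhds 0))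
    (hVI : ∀ x : X, J xdag - J x ≤ Φ ‖A x - A xdag‖) :
    ∀ x : X, J xdag ≤ J x := by
  intro x
  rcases (norm_nonneg (A x - A xdag)).eq_or_lt with hc | hc
  · have h := hVI x
    rw [← hc, hΦ0] at h
    linarith
  set c := ‖A x - A xdag‖ with hc_def
  have hbound : ∀ᶠ t in nhdsWithin (0 : ℝ) (Set.Ioi 0), (J xdag - J x) / c ≤ Φ t / t := by
    filter_upwards [Ioo_mem_nhdsGT hc] with t ht
    have hs0 : 0 < t / c := div_pos ht.1 hc
    have hs1 : t / c ≤ 1 := (div_le_one hc).2 ht.2.le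
    have hconv := hJconv.2 (Set.mem_univ xdag) (Set.mem_univ x)
      (sub_nonneg.2 hs1) hs0.le (sub_add_cancel 1 (t / c))
    have hvi := hVI ((1 - t / c) • xdag + (t / c) • x)
    have hA : A ((1 - t / c) • xdag + (t / c) • x) - A xdag = (t / c) • (A x - A xdag) := by
      simp only [map_add, map_smul]
      module
    rw [hA, norm_smul, Real.norm_of_nonneg hs0.le, ← hc_def, div_mul_cancel₀ _ hc.ne'] at hvi
    simp only [smul_eq_mul] at hconv
    rw [le_div_iff₀ ht.1]
    calc (J xdag - J x) / c * t = t / c * (J xdag - J x) := by ring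
      _ ≤ Φ t := by linarith
  have hle : (J xdag - J x) / c ≤ 0 := ge_of_tendsto hΦsuper hbound
  rw [div_le_iff₀ hc, zero_mul] at hle
  linarith
end

section
/- Let Φ : (0,∞) → (0,∞) be an index function such that t ↦ Φ(√t) is concave on (0,∞) and such that the quotient map s ↦ s²/Φ(s) is a strictly increasing continuous bijection from (0,∞) onto (0,∞). Then for every α > 0 the supremum Ψ(α) := sup_{t>0} ( Φ(t) − t²/(2α) ) is finite, and the function Ψ : (0,∞) → (0,∞) so defined is an index function (continuous, strictly increasing, and Ψ(α) → 0 as α → 0⁺). -/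
open Filter

/-- If `2α ≤ s² / Φ s`, then `Φ s` bounds `t ↦ Φ t - t² / (2α)` on `(0,∞)`. -/
theorem sub_sq_div_le_of_le_sq_div {Φ : ℝ → ℝ} (hΦpos : ∀ t > (0:ℝ), 0 < Φ t)
    (hΦmono : StrictMonoOn Φ (Set.Ioi 0))
    (hqmono : StrictMonoOn (fun s => s^2 / Φ s) (Set.Ioi 0))
    {α s t : ℝ} (hα : 0 < α) (hs : 0 < s) (hαs : 2 * α ≤ s^2 / Φ s) (ht : 0 < t) :
    Φ t - t^2 / (2*α) ≤ Φ s := by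
  have hsΦ := hΦpos s hs
  rcases le_total s t with h | h
  · have hq : 2 * α ≤ t^2 / Φ t := hαs.trans (hqmono.monotoneOn hs ht h)
    have hle : Φ t ≤ t^2 / (2*α) := by
      rw [le_div_iff₀ (hΦpos t ht)] at hq
      rw [le_div_iff₀ (by positivity)]
      linarith
    linarith
  · have hle := hΦmono.monotoneOn ht hs h
    have : 0 ≤ t^2 / (2*α) := by positivity
    linarith

/-- A pointwise supremum of the affine functions `β ↦ Φ t - β t²` is convex where it is finite. -/
theorem convexOn_sSup_sub_mul_sq {Φ : ℝ → ℝ}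
    (hbdd : ∀ β > (0:ℝ), BddAbove ((fun t => Φ t - β * t^2) '' Set.Ioi 0)) :
    ConvexOn ℝ (Set.Ioi 0) (fun β => sSup ((fun t => Φ t - β * t^2) '' Set.Ioi 0)) := by
  refine ⟨convex_Ioi 0, fun x hx y hy a b ha hb hab => ?_⟩
  refine csSup_le (Set.nonempty_Ioi.image _) ?_
  rintro _ ⟨t, ht, rfl⟩
  have h₁ := mul_le_mul_of_nonneg_left (le_csSup (hbdd x hx) (Set.mem_image_of_mem _ ht)) ha
  have h₂ := mul_le_mul_of_nonneg_left (le_csSup (hbdd y hy) (Set.mem_image_of_mem _ ht)) hb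
  simp only [smul_eq_mul] at *
  calc Φ t - (a * x + b * y) * t^2
      = a * (Φ t - x * t^2) + b * (Φ t - y * t^2) := by linear_combination -Φ t * hab
    _ ≤ _ := add_le_add h₁ h₂

/-- if `Φ` is an index function, `t ↦ Φ(√t)` is concave, and
`s ↦ s²/Φ(s)` is a strictly increasing continuous bijection of `(0,∞)` onto itself,
then `Ψ(α) := sup_{t>0} (Φ(t) − t²/(2α))` is finite for each `α > 0` and defines an
index function. -/
theorem stmt_7
    (Φ : ℝ → ℝ)
    -- Φ is an index function
    (hΦpos : ∀ t > (0:ℝ), 0 < Φ t)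
    (hΦmono : StrictMonoOn Φ (Set.Ioi 0))
    (hΦcont : ContinuousOn Φ (Set.Ioi 0))
    (hΦ0 : Tendsto Φ (nhdsWithin 0 (Set.Ioi 0)) (nhds 0))
    -- t ↦ Φ(√t) is concave on (0,∞)
    (hconc : ConcaveOn ℝ (Set.Ioi 0) (fun t => Φ (Real.sqrt t)))
    -- s ↦ s²/Φ(s) is a strictly increasing continuous bijection of (0,∞) onto (0,∞)
    (hqmono : StrictMonoOn (fun s => s^2 / Φ s) (Set.Ioi 0))
    (hqcont : ContinuousOn (fun s => s^2 / Φ s) (Set.Ioi 0))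
    (hqsurj : ∀ u > (0:ℝ), ∃ s > (0:ℝ), s^2 / Φ s = u) :
    (∀ α > (0:ℝ), BddAbove ((fun t => Φ t - t^2 / (2*α)) '' Set.Ioi 0)) ∧
      (∀ α > (0:ℝ), 0 < sSup ((fun t => Φ t - t^2 / (2*α)) '' Set.Ioi 0)) ∧
      StrictMonoOn (fun α => sSup ((fun t => Φ t - t^2 / (2*α)) '' Set.Ioi 0))
        (Set.Ioi 0) ∧
      ContinuousOn (fun α => sSup ((fun t => Φ t - t^2 / (2*α)) '' Set.Ioi 0))
        (Set.Ioi 0) ∧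
      Tendsto (fun α => sSup ((fun t => Φ t - t^2 / (2*α)) '' Set.Ioi 0))
        (nhdsWithin 0 (Set.Ioi 0)) (nhds 0) := by
  have hbdd : ∀ α > (0:ℝ), BddAbove ((fun t => Φ t - t^2 / (2*α)) '' Set.Ioi 0) := by
    intro α hα
    obtain ⟨s, hs, hsα⟩ := hqsurj (2*α) (by positivity)
    refine ⟨Φ s, ?_⟩
    rintro _ ⟨t, ht, rfl⟩
    exact sub_sq_div_le_of_le_sq_div hΦpos hΦmono hqmono hα hs hsα.ge ht
  have hpos : ∀ α > (0:ℝ), 0 < sSup ((fun t => Φ t - t^2 / (2*α)) '' Set.Ioi 0) := by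
    intro α hα
    obtain ⟨s, hs, hsα⟩ := hqsurj α hα
    refine lt_of_lt_of_le ?_ (le_csSup (hbdd α hα) (Set.mem_image_of_mem _ hs))
    have hsΦ := hΦpos s hs
    rw [div_eq_iff hsΦ.ne'] at hsα
    have : s^2 / (2*α) = Φ s / 2 := by rw [hsα]; field_simp
    simp only [this]
    linarith
  have hsmall : ∀ ε > (0:ℝ), ∃ δ > (0:ℝ), Φ δ < ε := by
    intro ε hε
    obtain ⟨δ, hδ, hδ₀⟩ :=
      ((hΦ0.eventually (gt_mem_nhds hε)).and self_mem_nhdsWithin).exists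
    exact ⟨δ, hδ₀, hδ⟩
  refine ⟨hbdd, hpos, ?_, ?_, ?_⟩
  · intro α hα β hβ hαβ
    rw [Set.mem_Ioi] at hα hβ
    have hΨ := hpos α hα
    obtain ⟨δ, hδ, hδΨ⟩ := hsmall _ (half_pos hΨ)
    have hc : 0 < 1 / (2*α) - 1 / (2*β) :=
      sub_pos.2 (one_div_lt_one_div_of_lt (by positivity) (by linarith))
    have hle : sSup ((fun t => Φ t - t^2 / (2*α)) '' Set.Ioi 0) ≤
        max (sSup ((fun t => Φ t - t^2 / (2*α)) '' Set.Ioi 0) / 2)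
          (sSup ((fun t => Φ t - t^2 / (2*β)) '' Set.Ioi 0)
            - δ^2 * (1 / (2*α) - 1 / (2*β))) := by
      refine csSup_le (Set.nonempty_Ioi.image _) ?_
      rintro _ ⟨t, ht, rfl⟩
      rw [Set.mem_Ioi] at ht
      rcases le_total t δ with h | h
      · refine le_max_of_le_left ?_
        have := hΦmono.monotoneOn ht hδ h
        have : 0 ≤ t^2 / (2*α) := by positivity
        linarith
      · refine le_max_of_le_right ?_
        have h₁ := le_csSup (hbdd β hβ) (Set.mem_image_of_mem _ ht)
        have h₂ : δ^2 * (1 / (2*α) - 1 / (2*β)) ≤ t^2 * (1 / (2*α) - 1 / (2*β)) := by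
          gcongr
        have h₃ : t^2 * (1 / (2*α) - 1 / (2*β)) = t^2 / (2*α) - t^2 / (2*β) := by ring
        simp only at h₁ ⊢
        linarith
    have : 0 < δ^2 * (1 / (2*α) - 1 / (2*β)) := by positivity
    rcases le_max_iff.1 hle with h | h
    · linarith
    · simp only
      linarith
  · have heq : ∀ α : ℝ, (fun t => Φ t - t^2 / (2*α)) = fun t => Φ t - (2*α)⁻¹ * t^2 :=
      fun α => funext fun t => by rw [div_eq_inv_mul]
    have hbdd' : ∀ β > (0:ℝ), BddAbove ((fun t => Φ t - β * t^2) '' Set.Ioi 0) := by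
      intro β hβ
      have h := hbdd (2*β)⁻¹ (by positivity)
      rwa [heq, show (2 * (2*β)⁻¹)⁻¹ = β by field_simp] at h
    have hG := (convexOn_sSup_sub_mul_sq hbdd').continuousOn isOpen_Ioi
    have hinv : ContinuousOn (fun α : ℝ => (2*α)⁻¹) (Set.Ioi 0) :=
      ContinuousOn.inv₀ (by fun_prop) fun α hα => mul_ne_zero two_ne_zero (ne_of_gt hα)
    simp only [heq]
    refine hG.comp hinv fun α hα => ?_
    rw [Set.mem_Ioi] at hα ⊢
    positivity
  · refine (nhdsGT_basis (0:ℝ)).tendsto_iff Metric.nhds_basis_ball |>.2 fun ε hε => ?_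
    obtain ⟨δ, hδ, hδε⟩ := hsmall ε hε
    have hδΦ := hΦpos δ hδ
    refine ⟨δ^2 / Φ δ / 2, by positivity, fun α hα => ?_⟩
    rw [mem_ball_zero_iff, Real.norm_of_nonneg (hpos α hα.1).le]
    refine lt_of_le_of_lt (csSup_le (Set.nonempty_Ioi.image _) ?_) hδε
    rintro _ ⟨t, ht, rfl⟩
    exact sub_sq_div_le_of_le_sq_div hΦpos hΦmono hqmono hα.1 hδ (by linarith [hα.2]) ht
end

section
/- Let Φ : [0,∞) → [0,∞) be continuous and strictly increasing with Φ(0) = 0, such that Φ̃(t) := Φ(√t) is a concave bijection from [0,∞) onto [0,∞) with inverse g. Assume the variational inequality J(x†) − J(x) ≤ Φ(‖A x − A x†‖) for all x ∈ X. Fix δ > 0 and let α > 0 satisfy the subgradient condition g(s) ≥ δ² + 2α·(s − Φ(δ)) for all s ≥ 0 (i.e. 2α is a subgradient slope of g at the point Φ(δ)). Let x_α be a minimizer of T_α(·; y) with a subgradient ξ_α of J at x_α satisfying the optimality condition for (α, y); let y_δ ∈ H with ‖y_δ − y‖ ≤ δ, let x_αδ be a minimizer of T_α(·; y_δ), and let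 ξ_αδ be a subgradient of J at x_αδ satisfying the optimality condition for (α, y_δ). Then B_{ξ_αδ}(x_αδ; x†) ≤ Φ(δ). -/
open RealInnerProductSpace

/-- under the variational inequality with `Φ`, where `Φ̃(t) = Φ(√t)` is a
concave bijection of `[0,∞)` onto itself with inverse `g`, and with `α` chosen so that
`2α` is a subgradient slope of `g` at `Φ(δ)`, the Bregman distance satisfies
`B_{ξ_αδ}(x_αδ; x†) ≤ Φ(δ)`. -/
theorem stmt_8
    {X H : Type*} [NormedAddCommGroup X] [NormedSpace ℝ X]
    [NormedAddCommGroup H] [InnerProductSpace ℝ H]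
    (A : X →L[ℝ] H) (J : X → ℝ)
    (hJconv : ConvexOn ℝ Set.univ J) (hJnonneg : ∀ x, 0 ≤ J x)
    (T : ℝ → H → X → ℝ)
    (hT : ∀ α v x, T α v x = (1/2) * ‖A x - v‖^2 + α * J x)
    (xdag : X) (y : H) (hy : y = A xdag)
    (Φ g : ℝ → ℝ)
    (hΦcont : ContinuousOn Φ (Set.Ici 0))
    (hΦmono : StrictMonoOn Φ (Set.Ici 0))
    (hΦ0 : Φ 0 = 0) (hΦnonneg : ∀ t ≥ (0:ℝ), 0 ≤ Φ t)
    (hconc : ConcaveOn ℝ (Set.Ici 0) (fun t => Φ (Real.sqrt t)))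
    (hgnonneg : ∀ s ≥ (0:ℝ), 0 ≤ g s)
    (hg_left : ∀ t ≥ (0:ℝ), g (Φ (Real.sqrt t)) = t)
    (hg_right : ∀ s ≥ (0:ℝ), Φ (Real.sqrt (g s)) = s)
    (hVI : ∀ x : X, J xdag - J x ≤ Φ ‖A x - A xdag‖)
    (δ : ℝ) (hδ : 0 < δ)
    (α : ℝ) (hα : 0 < α)
    (hslope : ∀ s ≥ (0:ℝ), g s ≥ δ^2 + 2*α*(s - Φ δ))
    (xα : X) (hxα : ∀ x, T α y xα ≤ T α y x)
    (ξα : X →L[ℝ] ℝ)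
    (hξα_sub : ∀ x, J xα + ξα (x - xα) ≤ J x)
    (hξα_opt : ∀ w, ⟪A xα - y, A w⟫ + α * ξα w = 0)
    (yδ : H) (hyδ : ‖yδ - y‖ ≤ δ)
    (xαδ : X) (hxαδ : ∀ x, T α yδ xαδ ≤ T α yδ x)
    (ξαδ : X →L[ℝ] ℝ)
    (hξαδ_sub : ∀ x, J xαδ + ξαδ (x - xαδ) ≤ J x)
    (hξαδ_opt : ∀ w, ⟪A xαδ - yδ, A w⟫ + α * ξαδ w = 0) :
    J xdag - J xαδ - ξαδ (xdag - xαδ) ≤ Φ δ := by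
  subst hy
  set r : H := A xαδ - A xdag with hr
  have hslope_r := hslope (Φ ‖r‖) (hΦnonneg _ (norm_nonneg r))
  have hg_r : g (Φ ‖r‖) = ‖r‖ ^ 2 := by
    simpa [Real.sqrt_sq (norm_nonneg r)] using hg_left (‖r‖ ^ 2) (sq_nonneg _)
  rw [hg_r] at hslope_r
  have hopt := hξαδ_opt (xdag - xαδ)
  have hres : A xαδ - yδ = r - (yδ - A xdag) := by rw [hr]; abel
  have hdir : A (xdag - xαδ) = -r := by rw [map_sub, hr]; abel
  rw [hres, hdir, inner_neg_right, inner_sub_left, real_inner_self_eq_norm_sq] at hopt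
  have hnoise : ⟪yδ - A xdag, r⟫ ≤ δ * ‖r‖ :=
    (real_inner_le_norm _ _).trans (by gcongr)
  have hVI_r := mul_le_mul_of_nonneg_left (hVI xαδ) hα.le
  rw [← hr] at hVI_r
  refine le_of_mul_le_mul_left ?_ hα
  nlinarith [sq_nonneg (‖r‖ - δ)]
end

section
/- Fix α > 0 and δ ≥ 0. Let x_α be a minimizer of T_α(·; y), let y_δ ∈ H with ‖y_δ − y‖ ≤ δ, let x_αδ ∈ X, and let ξ_αδ be a subgradient of J at x_αδ satisfying the optimality condition for (α, y_δ). Then, with r_α := A x_α − y and r_αδ := A x_αδ − y_δ, the Bregman distance satisfies B_{ξ_αδ}(x_αδ; x_α) ≤ δ²/(2α) − ‖r_α‖²/(2α) + (1/α)·⟨r_αδ, r_α⟩. -/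
open RealInnerProductSpace

/-- with residuals `r_α = A x_α − y` and `r_αδ = A x_αδ − y_δ`,
the bound `B_{ξ_αδ}(x_αδ; x_α) ≤ δ²/(2α) − ‖r_α‖²/(2α) + (1/α)⟨r_αδ, r_α⟩` holds. -/
theorem stmt_10
    {X H : Type*} [NormedAddCommGroup X] [NormedSpace ℝ X]
    [NormedAddCommGroup H] [InnerProductSpace ℝ H]
    (A : X →L[ℝ] H) (J : X → ℝ)
    (hJconv : ConvexOn ℝ Set.univ J) (hJnonneg : ∀ x, 0 ≤ J x)
    (T : ℝ → H → X → ℝ)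
    (hT : ∀ α v x, T α v x = (1/2) * ‖A x - v‖^2 + α * J x)
    (xdag : X) (y : H) (hy : y = A xdag)
    (α δ : ℝ) (hα : 0 < α) (hδ : 0 ≤ δ)
    (xα : X) (hxα : ∀ x, T α y xα ≤ T α y x)
    (yδ : H) (hyδ : ‖yδ - y‖ ≤ δ)
    (xαδ : X) (ξαδ : X →L[ℝ] ℝ)
    (hξαδ_sub : ∀ x, J xαδ + ξαδ (x - xαδ) ≤ J x)
    (hξαδ_opt : ∀ w, ⟪A xαδ - yδ, A w⟫ + α * ξαδ w = 0) :
    J xα - J xαδ - ξαδ (xα - xαδ) ≤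
      δ^2 / (2*α) - ‖A xα - y‖^2 / (2*α) + (1/α) * ⟪A xαδ - yδ, A xα - y⟫ := by
  have hmin := hxα xαδ
  rw [hT, hT] at hmin
  have hopt := hξαδ_opt (xα - xαδ)
  have hA : A (xα - xαδ) = (A xα - y) - ((A xαδ - yδ) + (yδ - y)) := by
    rw [map_sub]; abel
  have hres : A xαδ - y = (A xαδ - yδ) + (yδ - y) := by abel
  rw [hA, inner_sub_right, inner_add_right, real_inner_self_eq_norm_sq] at hopt
  rw [hres, norm_add_sq_real] at hmin
  have hnoise : ‖yδ - y‖ ^ 2 ≤ δ ^ 2 := by gcongr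
  have hrhs : δ^2 / (2*α) - ‖A xα - y‖^2 / (2*α) + (1/α) * ⟪A xαδ - yδ, A xα - y⟫ =
      (δ^2 / 2 - ‖A xα - y‖^2 / 2 + ⟪A xαδ - yδ, A xα - y⟫) / α := by
    field_simp
  rw [hrhs, le_div_iff₀ hα]
  linarith [sq_nonneg ‖A xαδ - yδ‖]
end

section
/- Let f : (0,∞) → (0,∞) be a convex index function. Then the following are equivalent: (1) the quotient map q(t) := f(t)/t is a strictly increasing continuous bijection from (0,∞) onto (0,∞) with q(t) → 0 as t → 0⁺; (2) there exists a strictly increasing continuous bijection φ from (0,∞) onto (0,∞) with φ(t) → 0 as t → 0⁺ such that, with Θ(t) := √t·φ(t), the representation f(t) = Θ( (φ²)⁻¹(t) )² holds for all t > 0, where (φ²)⁻¹ denotes the inverse of the map t ↦ φ(t)². -/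
open Filter

/-- A strictly increasing positive surjection of `(0,∞)` onto itself is continuous. -/
lemma StrictMonoOn.continuousOn_Ioi_of_surj {g : ℝ → ℝ}
    (hpos : ∀ t > (0 : ℝ), 0 < g t) (hmono : StrictMonoOn g (Set.Ioi 0))
    (hsurj : ∀ u > (0 : ℝ), ∃ t > (0 : ℝ), g t = u) : ContinuousOn g (Set.Ioi 0) := by
  intro a ha
  refine (hmono.continuousAt_of_image_mem_nhds (Ioi_mem_nhds ha) ?_).continuousWithinAt
  exact mem_of_superset (Ioi_mem_nhds (hpos a ha)) fun u hu => hsurj u hu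

/-- A strictly increasing positive surjection of `(0,∞)` onto itself tends to `0` at `0⁺`. -/
lemma StrictMonoOn.tendsto_zero_of_surj {g : ℝ → ℝ}
    (hpos : ∀ t > (0 : ℝ), 0 < g t) (hmono : StrictMonoOn g (Set.Ioi 0))
    (hsurj : ∀ u > (0 : ℝ), ∃ t > (0 : ℝ), g t = u) :
    Tendsto g (nhdsWithin 0 (Set.Ioi 0)) (nhds 0) := by
  refine tendsto_order.2 ⟨fun b hb => ?_, fun b hb => ?_⟩
  · filter_upwards [self_mem_nhdsWithin] with x hx
    exact hb.trans (hpos x hx)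
  · obtain ⟨t, ht, rfl⟩ := hsurj b hb
    filter_upwards [Ioo_mem_nhdsGT ht] with x hx
    exact hmono hx.1 ht hx.2

/-- for a convex index function `f`, the quotient `t ↦ f(t)/t` is a
strictly increasing continuous bijection of `(0,∞)` onto itself tending to `0` at `0⁺`
iff there is a strictly increasing continuous bijection `φ` of `(0,∞)` onto itself with
`φ → 0` at `0⁺` such that, with `Θ(t) = √t·φ(t)` and `(φ²)⁻¹` the inverse of `t ↦ φ(t)²`,
one has `f(t) = Θ((φ²)⁻¹(t))²` for all `t > 0`. -/
theorem stmt_11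
    (f : ℝ → ℝ)
    -- f is a convex index function
    (hfpos : ∀ t > (0:ℝ), 0 < f t)
    (hfmono : StrictMonoOn f (Set.Ioi 0))
    (hfcont : ContinuousOn f (Set.Ioi 0))
    (hf0 : Tendsto f (nhdsWithin 0 (Set.Ioi 0)) (nhds 0))
    (hfconv : ConvexOn ℝ (Set.Ioi 0) f) :
    -- (1) the quotient map is a strictly increasing continuous bijection of (0,∞)
    -- onto itself tending to 0 at 0⁺
    (StrictMonoOn (fun t => f t / t) (Set.Ioi 0) ∧
       ContinuousOn (fun t => f t / t) (Set.Ioi 0) ∧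
       (∀ u > (0:ℝ), ∃ t > (0:ℝ), f t / t = u) ∧
       Tendsto (fun t => f t / t) (nhdsWithin 0 (Set.Ioi 0)) (nhds 0))
    ↔
    -- (2) the representation f(t) = Θ((φ²)⁻¹(t))², Θ(t) = √t·φ(t)
    (∃ φ ψ : ℝ → ℝ,
       (∀ t > (0:ℝ), 0 < φ t) ∧
       StrictMonoOn φ (Set.Ioi 0) ∧
       ContinuousOn φ (Set.Ioi 0) ∧
       (∀ s > (0:ℝ), ∃ t > (0:ℝ), φ t = s) ∧
       Tendsto φ (nhdsWithin 0 (Set.Ioi 0)) (nhds 0) ∧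
       (∀ t > (0:ℝ), 0 < ψ t) ∧
       (∀ t > (0:ℝ), ψ ((φ t)^2) = t) ∧
       (∀ t > (0:ℝ), (φ (ψ t))^2 = t) ∧
       (∀ t > (0:ℝ), f t = (Real.sqrt (ψ t) * φ (ψ t))^2)) := by
  constructor
  · rintro ⟨hq, -, hsurj, -⟩
    have hqpos : ∀ t > (0 : ℝ), 0 < f t / t := fun t ht => div_pos (hfpos t ht) ht
    choose! r hrpos hr using hsurj
    have hrq : ∀ t > (0 : ℝ), r (f t / t) = t := fun t ht =>
      hq.injOn (hrpos _ (hqpos t ht)) ht (hr _ (hqpos t ht))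
    have hpos : ∀ t > (0 : ℝ), 0 < √(r t) := fun t ht => Real.sqrt_pos.2 (hrpos t ht)
    have hmono : StrictMonoOn (fun t => √(r t)) (Set.Ioi 0) := by
      intro a ha b hb hab
      refine Real.sqrt_lt_sqrt (hrpos a ha).le ((hq.lt_iff_lt (hrpos a ha) (hrpos b hb)).1 ?_)
      simpa only [hr a ha, hr b hb] using hab
    have hsurj : ∀ s > (0 : ℝ), ∃ t > (0 : ℝ), √(r t) = s := fun s hs =>
      ⟨_, hqpos _ (pow_pos hs 2), by rw [hrq _ (pow_pos hs 2), Real.sqrt_sq hs.le]⟩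
    refine ⟨fun t => √(r t), fun t => f t / t, hpos, hmono, hmono.continuousOn_Ioi_of_surj hpos hsurj,
      hsurj, hmono.tendsto_zero_of_surj hpos hsurj, hqpos, fun t ht => ?_, fun t ht => ?_,
      fun t ht => ?_⟩
    · simp only [Real.sq_sqrt (hrpos t ht).le, hr t ht]
    · simp only [hrq t ht, Real.sq_sqrt ht.le]
    · rw [mul_pow, Real.sq_sqrt (hqpos t ht).le]
      simp only [hrq t ht, Real.sq_sqrt ht.le]
      exact (div_mul_cancel₀ _ ht.ne').symm
  · rintro ⟨φ, ψ, hφpos, hφ, -, -, -, hψpos, hψφ, hφψ, hrep⟩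
    have hqψ : ∀ t > (0 : ℝ), f t / t = ψ t := fun t ht => by
      rw [hrep t ht, mul_pow, Real.sq_sqrt (hψpos t ht).le, hφψ t ht, mul_div_cancel_right₀ _ ht.ne']
    have hpos : ∀ t > (0 : ℝ), 0 < f t / t := fun t ht => div_pos (hfpos t ht) ht
    have hmono : StrictMonoOn (fun t => f t / t) (Set.Ioi 0) := by
      intro a ha b hb hab
      simp only [hqψ a ha, hqψ b hb]
      refine (hφ.lt_iff_lt (hψpos a ha) (hψpos b hb)).1 (lt_of_pow_lt_pow_left₀ 2 ?_ ?_)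
      · exact (hφpos _ (hψpos b hb)).le
      · rwa [hφψ a ha, hφψ b hb]
    have hsurj : ∀ u > (0 : ℝ), ∃ t > (0 : ℝ), f t / t = u := fun u hu =>
      have h := pow_pos (hφpos u hu) 2
      ⟨_, h, (hqψ _ h).trans (hψφ u hu)⟩
    exact ⟨hmono, hmono.continuousOn_Ioi_of_surj hpos hsurj, hsurj,
      hmono.tendsto_zero_of_surj hpos hsurj⟩
end

section
/- Let f : (0,∞) → (0,∞) be a convex index function such that the quotient map t ↦ f(t)/t is a strictly increasing continuous bijection from (0,∞) onto (0,∞) tending to 0 as t → 0⁺. Then the Fenchel conjugate f*(t) := sup_{s>0} ( s·t − f(s) ) is finite for every t > 0, the function f* is an index function, and there exists a strictly increasing continuous bijection φ from (0,∞) onto (0,∞) with φ(t) → 0 as t → 0⁺ such that f*(t) ≤ t·φ(t)² for all t > 0. -/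
open Filter

/-- A strictly increasing surjection of `(0,∞)` onto itself is continuous. -/
theorem StrictMonoOn.continuousOn_Ioi_of_surjOn {φ : ℝ → ℝ}
    (hpos : ∀ t > (0 : ℝ), 0 < φ t) (hmono : StrictMonoOn φ (Set.Ioi 0))
    (hsurj : ∀ s > (0 : ℝ), ∃ t > (0 : ℝ), φ t = s) : ContinuousOn φ (Set.Ioi 0) := by
  intro a ha
  refine (hmono.continuousAt_of_image_mem_nhds (Ioi_mem_nhds ha) ?_).continuousWithinAt
  exact mem_of_superset (Ioi_mem_nhds (hpos a ha)) fun s hs => hsurj s hs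

/-- A strictly increasing surjection of `(0,∞)` onto itself tends to `0` at `0⁺`. -/
theorem StrictMonoOn.tendsto_nhdsGT_zero_of_surjOn {φ : ℝ → ℝ}
    (hpos : ∀ t > (0 : ℝ), 0 < φ t) (hmono : StrictMonoOn φ (Set.Ioi 0))
    (hsurj : ∀ s > (0 : ℝ), ∃ t > (0 : ℝ), φ t = s) :
    Tendsto φ (nhdsWithin 0 (Set.Ioi 0)) (nhds 0) := by
  refine tendsto_order.2 ⟨fun a ha => ?_, fun b hb => ?_⟩
  · filter_upwards [self_mem_nhdsWithin] with t ht using ha.trans (hpos t ht)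
  · obtain ⟨c, hc, rfl⟩ := hsurj b hb
    filter_upwards [Ioo_mem_nhdsGT hc] with t ht using hmono ht.1 hc ht.2

/-- A strictly increasing surjection `q` of `(0,∞)` onto itself has an inverse whose square root
is again a strictly increasing surjection: there is `φ` with `q (φ u ^ 2) = u`. -/
theorem StrictMonoOn.exists_sqrt_inverse {q : ℝ → ℝ}
    (hpos : ∀ t > (0 : ℝ), 0 < q t) (hmono : StrictMonoOn q (Set.Ioi 0))
    (hsurj : ∀ u > (0 : ℝ), ∃ t > (0 : ℝ), q t = u) :
    ∃ φ : ℝ → ℝ, (∀ t > (0 : ℝ), 0 < φ t) ∧ StrictMonoOn φ (Set.Ioi 0) ∧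
      (∀ s > (0 : ℝ), ∃ t > (0 : ℝ), φ t = s) ∧ ∀ u > (0 : ℝ), q (φ u ^ 2) = u := by
  have hex : ∀ u : ℝ, ∃ t, 0 < u → 0 < t ∧ q (t ^ 2) = u := by
    intro u
    by_cases hu : 0 < u
    · obtain ⟨t, ht, rfl⟩ := hsurj u hu
      exact ⟨√t, fun _ => ⟨Real.sqrt_pos.2 ht, by rw [Real.sq_sqrt ht.le]⟩⟩
    · exact ⟨0, fun h => absurd h hu⟩
  choose φ hφ using hex
  have hφpos : ∀ t > (0 : ℝ), 0 < φ t := fun t ht => (hφ t ht).1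
  have hqφ : ∀ t > (0 : ℝ), q (φ t ^ 2) = t := fun t ht => (hφ t ht).2
  refine ⟨φ, hφpos, ?_, ?_, hqφ⟩
  · intro a ha b hb hab
    have hlt : φ a ^ 2 < φ b ^ 2 := by
      rw [← hmono.lt_iff_lt (pow_pos (hφpos a ha) 2) (pow_pos (hφpos b hb) 2), hqφ a ha, hqφ b hb]
      exact hab
    exact lt_of_pow_lt_pow_left₀ 2 (hφpos b hb).le hlt
  · intro s hs
    have hs2 : 0 < s ^ 2 := pow_pos hs 2
    have hq := hpos _ hs2
    refine ⟨q (s ^ 2), hq, ?_⟩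
    have heq := hmono.injOn (pow_pos (hφpos _ hq) 2) hs2 (hqφ _ hq)
    exact (pow_left_inj₀ (hφpos _ hq).le hs.le two_ne_zero).1 heq

/-- If `f s / s` is increasing with value `t` at `r`, the affine functionals defining the Fenchel
conjugate of `f` at `t` are bounded by `t * r`. -/
theorem mul_sub_le_of_monotoneOn_div {f : ℝ → ℝ} (hfpos : ∀ t > (0 : ℝ), 0 < f t)
    (hq : MonotoneOn (fun t => f t / t) (Set.Ioi 0)) {r s t : ℝ} (hr : 0 < r) (hs : 0 < s)
    (ht : 0 < t) (hrt : f r / r = t) : s * t - f s ≤ t * r := by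
  rcases le_total s r with h | h
  · nlinarith [hfpos s hs]
  · have hle : f r / r ≤ f s / s := hq hr hs h
    rw [hrt, le_div_iff₀ hs] at hle
    nlinarith [mul_pos ht hr]

/-- A finite Fenchel conjugate is convex. -/
theorem convexOn_sSup_mul_sub {f : ℝ → ℝ}
    (hbdd : ∀ t > (0 : ℝ), BddAbove ((fun s => s * t - f s) '' Set.Ioi 0)) :
    ConvexOn ℝ (Set.Ioi 0) (fun t => sSup ((fun s => s * t - f s) '' Set.Ioi 0)) := by
  refine ⟨convex_Ioi 0, fun x hx y hy a b ha hb hab => ?_⟩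
  refine csSup_le (Set.nonempty_Ioi.image _) ?_
  rintro _ ⟨s, hs, rfl⟩
  have h1 := le_csSup (hbdd x hx) (Set.mem_image_of_mem _ hs)
  have h2 := le_csSup (hbdd y hy) (Set.mem_image_of_mem _ hs)
  simp only [smul_eq_mul] at h1 h2 ⊢
  calc s * (a * x + b * y) - f s
      = a * (s * x - f s) + b * (s * y - f s) := by linear_combination f s * hab
    _ ≤ _ := add_le_add (mul_le_mul_of_nonneg_left h1 ha) (mul_le_mul_of_nonneg_left h2 hb)

/-- A finite positive Fenchel conjugate of a positive function is strictly increasing. -/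
theorem strictMonoOn_sSup_mul_sub {f : ℝ → ℝ} (hfpos : ∀ t > (0 : ℝ), 0 < f t)
    (hbdd : ∀ t > (0 : ℝ), BddAbove ((fun s => s * t - f s) '' Set.Ioi 0))
    (hpos : ∀ t > (0 : ℝ), 0 < sSup ((fun s => s * t - f s) '' Set.Ioi 0)) :
    StrictMonoOn (fun t => sSup ((fun s => s * t - f s) '' Set.Ioi 0)) (Set.Ioi 0) := by
  intro a ha b hb hab
  have ha0 : 0 < a := ha
  have hga := hpos a ha
  dsimp only
  set A := sSup ((fun s => s * a - f s) '' Set.Ioi 0) with hA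
  set B := sSup ((fun s => s * b - f s) '' Set.Ioi 0) with hB
  by_contra! hBA
  have hc : 0 < A / (2 * a) * (b - a) := mul_pos (by positivity) (sub_pos.2 hab)
  have hle : A ≤ max (A / 2) (B - A / (2 * a) * (b - a)) := by
    refine csSup_le (Set.nonempty_Ioi.image _) ?_
    rintro _ ⟨s, hs, rfl⟩
    have hs0 : 0 < s := hs
    rcases le_total s (A / (2 * a)) with h | h
    · refine le_max_of_le_left ?_
      have := mul_le_mul_of_nonneg_right h ha0.le
      have hAa : A / (2 * a) * a = A / 2 := by field_simp
      linarith [hfpos s hs]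
    · refine le_max_of_le_right ?_
      have h1 : s * b - f s ≤ B := le_csSup (hbdd b hb) (Set.mem_image_of_mem _ hs)
      have := mul_le_mul_of_nonneg_right h (sub_pos.2 hab).le
      dsimp only
      linarith
  rcases le_max_iff.1 hle with h | h <;> linarith

/-- for a convex index function `f` whose quotient `t ↦ f(t)/t` is a
strictly increasing continuous bijection of `(0,∞)` onto itself tending to `0` at `0⁺`,
the Fenchel conjugate `f*(t) = sup_{s>0}(st − f(s))` is finite for each `t > 0`, is an
index function, and is bounded by `f*(t) ≤ t·φ(t)²` for some strictly increasing
continuous bijection `φ` of `(0,∞)` onto itself with `φ → 0` at `0⁺`. -/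
theorem stmt_12
    (f : ℝ → ℝ)
    -- f is a convex index function
    (hfpos : ∀ t > (0:ℝ), 0 < f t)
    (hfmono : StrictMonoOn f (Set.Ioi 0))
    (hfcont : ContinuousOn f (Set.Ioi 0))
    (hf0 : Tendsto f (nhdsWithin 0 (Set.Ioi 0)) (nhds 0))
    (hfconv : ConvexOn ℝ (Set.Ioi 0) f)
    -- the quotient map is a strictly increasing continuous bijection of (0,∞) onto
    -- itself tending to 0 at 0⁺
    (hqmono : StrictMonoOn (fun t => f t / t) (Set.Ioi 0))
    (hqcont : ContinuousOn (fun t => f t / t) (Set.Ioi 0))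
    (hqsurj : ∀ u > (0:ℝ), ∃ t > (0:ℝ), f t / t = u)
    (hq0 : Tendsto (fun t => f t / t) (nhdsWithin 0 (Set.Ioi 0)) (nhds 0)) :
    (∀ t > (0:ℝ), BddAbove ((fun s => s * t - f s) '' Set.Ioi 0)) ∧
      (∀ t > (0:ℝ), 0 < sSup ((fun s => s * t - f s) '' Set.Ioi 0)) ∧
      StrictMonoOn (fun t => sSup ((fun s => s * t - f s) '' Set.Ioi 0)) (Set.Ioi 0) ∧
      ContinuousOn (fun t => sSup ((fun s => s * t - f s) '' Set.Ioi 0)) (Set.Ioi 0) ∧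
      Tendsto (fun t => sSup ((fun s => s * t - f s) '' Set.Ioi 0))
        (nhdsWithin 0 (Set.Ioi 0)) (nhds 0) ∧
      ∃ φ : ℝ → ℝ,
        (∀ t > (0:ℝ), 0 < φ t) ∧
        StrictMonoOn φ (Set.Ioi 0) ∧
        ContinuousOn φ (Set.Ioi 0) ∧
        (∀ s > (0:ℝ), ∃ t > (0:ℝ), φ t = s) ∧
        Tendsto φ (nhdsWithin 0 (Set.Ioi 0)) (nhds 0) ∧
        ∀ t > (0:ℝ), sSup ((fun s => s * t - f s) '' Set.Ioi 0) ≤ t * (φ t)^2 := by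
  have hqpos : ∀ t > (0 : ℝ), 0 < f t / t := fun t ht => div_pos (hfpos t ht) ht
  obtain ⟨φ, hφpos, hφmono, hφsurj, hqφ⟩ := hqmono.exists_sqrt_inverse hqpos hqsurj
  have hφ0 := hφmono.tendsto_nhdsGT_zero_of_surjOn hφpos hφsurj
  have hub : ∀ t > (0 : ℝ), ∀ y ∈ (fun s => s * t - f s) '' Set.Ioi 0, y ≤ t * φ t ^ 2 := by
    rintro t ht _ ⟨s, hs, rfl⟩
    exact mul_sub_le_of_monotoneOn_div hfpos hqmono.monotoneOn (pow_pos (hφpos t ht) 2) hs ht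
      (hqφ t ht)
  have hbdd : ∀ t > (0 : ℝ), BddAbove ((fun s => s * t - f s) '' Set.Ioi 0) :=
    fun t ht => ⟨_, hub t ht⟩
  have hle : ∀ t > (0 : ℝ), sSup ((fun s => s * t - f s) '' Set.Ioi 0) ≤ t * φ t ^ 2 :=
    fun t ht => csSup_le (Set.nonempty_Ioi.image _) (hub t ht)
  have hpos : ∀ t > (0 : ℝ), 0 < sSup ((fun s => s * t - f s) '' Set.Ioi 0) := by
    intro t ht
    obtain ⟨s, hs, hst⟩ := hqsurj (t / 2) (half_pos ht)
    rw [div_eq_iff hs.ne'] at hst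
    refine lt_of_lt_of_le ?_ (le_csSup (hbdd t ht) (Set.mem_image_of_mem _ hs))
    rw [hst]
    nlinarith [mul_pos hs ht]
  refine ⟨hbdd, hpos, strictMonoOn_sSup_mul_sub hfpos hbdd hpos,
    (convexOn_sSup_mul_sub hbdd).continuousOn isOpen_Ioi, ?_,
    φ, hφpos, hφmono, hφmono.continuousOn_Ioi_of_surjOn hφpos hφsurj, hφsurj, hφ0, hle⟩
  have hlim : Tendsto (fun t => t * φ t ^ 2) (nhdsWithin 0 (Set.Ioi 0)) (nhds 0) := by
    simpa using (tendsto_nhdsWithin_of_tendsto_nhds tendsto_id).mul (hφ0.pow 2)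
  refine tendsto_of_tendsto_of_tendsto_of_le_of_le' tendsto_const_nhds hlim ?_ ?_
  · filter_upwards [self_mem_nhdsWithin] with t ht using (hpos t ht).le
  · filter_upwards [self_mem_nhdsWithin] with t ht using hle t ht
end

section
/- Singular case: suppose J(x†) ≤ J(x) for all x ∈ X (x† minimizes the penalty J). Fix α > 0, let y_δ ∈ H, and suppose there exists x̄ ∈ X with A x̄ = y_δ and J(x̄) ≤ J(x†). Let x_αδ be a minimizer of T_α(·; y_δ) and let ξ_αδ be a subgradient of J at x_αδ satisfying the optimality condition for (α, y_δ). Then A x_αδ = y_δ, ξ_αδ = 0, and the Bregman distance vanishes: B_{ξ_αδ}(x_αδ; x†) = 0. -/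
open RealInnerProductSpace

/-- singular case: if `x†` minimizes `J` globally and `y_δ` is
attainable with penalty value at most `J(x†)`, then the regularized solution is exact
(`A x_αδ = y_δ`), the chosen subgradient vanishes, and the Bregman distance is zero. -/
theorem stmt_15
    {X H : Type*} [NormedAddCommGroup X] [NormedSpace ℝ X]
    [NormedAddCommGroup H] [InnerProductSpace ℝ H]
    (A : X →L[ℝ] H) (J : X → ℝ)
    (hJconv : ConvexOn ℝ Set.univ J) (hJnonneg : ∀ x, 0 ≤ J x)
    (T : ℝ → H → X → ℝ)
    (hT : ∀ α v x, T α v x = (1/2) * ‖A x - v‖^2 + α * J x)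
    (xdag : X)
    (hsing : ∀ x : X, J xdag ≤ J x)
    (α : ℝ) (hα : 0 < α)
    (yδ : H) (xbar : X) (hxbar : A xbar = yδ) (hxbarJ : J xbar ≤ J xdag)
    (xαδ : X) (hxαδ : ∀ x, T α yδ xαδ ≤ T α yδ x)
    (ξαδ : X →L[ℝ] ℝ)
    (hξαδ_sub : ∀ x, J xαδ + ξαδ (x - xαδ) ≤ J x)
    (hξαδ_opt : ∀ w, ⟪A xαδ - yδ, A w⟫ + α * ξαδ w = 0) :
    A xαδ = yδ ∧ ξαδ = 0 ∧ J xdag - J xαδ - ξαδ (xdag - xαδ) = 0 := by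
  have hmin : T α yδ xαδ ≤ T α yδ xbar := hxαδ xbar
  simp only [hT, hxbar, sub_self, norm_zero] at hmin
  have hJbar : α * J xbar ≤ α * J xdag := mul_le_mul_of_nonneg_left hxbarJ hα.le
  have hJdag : α * J xdag ≤ α * J xαδ := mul_le_mul_of_nonneg_left (hsing xαδ) hα.le
  have hres : A xαδ - yδ = 0 :=
    norm_eq_zero.1 (pow_eq_zero_iff two_ne_zero |>.1 (by nlinarith [sq_nonneg ‖A xαδ - yδ‖]))
  have hJeq : J xαδ = J xdag := by
    refine le_antisymm (le_of_mul_le_mul_left ?_ hα) (hsing xαδ)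
    nlinarith [sq_nonneg ‖A xαδ - yδ‖]
  have hξ : ξαδ = 0 := by
    ext w
    simpa [hres, hα.ne'] using hξαδ_opt w
  exact ⟨sub_eq_zero.1 hres, hξ, by simp [hξ, hJeq]⟩
end

section
/- Let x_α := R(B x†), the minimizer of the quadratic Tikhonov functional with exact data. Then the defect of the penalty satisfies J(x†) − J(x_α) = (1/2)·(‖x†‖² − ‖x_α‖²) ≤ α·⟨R x†, x†⟩. -/
open RealInnerProductSpace ContinuousLinearMap

/-- for quadratic Tikhonov regularization in Hilbert spaces, with
`x_α = (αI + A*A)⁻¹ A*A x†`, the defect of the penalty satisfies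
`J(x†) − J(x_α) = (1/2)(‖x†‖² − ‖x_α‖²) ≤ α⟨R x†, x†⟩`. -/
theorem stmt_18
    {X H : Type*} [NormedAddCommGroup X] [InnerProductSpace ℝ X] [CompleteSpace X]
    [NormedAddCommGroup H] [InnerProductSpace ℝ H] [CompleteSpace H]
    (A : X →L[ℝ] H) (B : X →L[ℝ] X) (hB : B = (ContinuousLinearMap.adjoint A).comp A)
    (α : ℝ) (hα : 0 < α)
    (R : X →L[ℝ] X)
    (hR1 : R.comp (α • ContinuousLinearMap.id ℝ X + B) = ContinuousLinearMap.id ℝ X)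
    (hR2 : (α • ContinuousLinearMap.id ℝ X + B).comp R = ContinuousLinearMap.id ℝ X)
    (J : X → ℝ) (hJ : ∀ x, J x = (1/2) * ‖x‖^2)
    (xdag : X)
    (xα : X) (hxα : xα = R (B xdag)) :
    J xdag - J xα = (1/2) * (‖xdag‖^2 - ‖xα‖^2) ∧
      (1/2) * (‖xdag‖^2 - ‖xα‖^2) ≤ α * ⟪R xdag, xdag⟫ := by
  have hx : xα = xdag - α • R xdag := by
    have h := congrArg (fun T : X →L[ℝ] X => T xdag) hR1
    simp only [comp_apply, add_apply, smul_apply, id_apply, map_add, map_smul] at h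
    rw [hxα]
    exact eq_sub_of_add_eq' h
  refine ⟨by rw [hJ, hJ]; ring, ?_⟩
  have hnorm : ‖xα‖^2 = ‖xdag‖^2 - 2 * (α * ⟪R xdag, xdag⟫) + ‖α • R xdag‖^2 := by
    rw [hx, norm_sub_sq_real, real_inner_smul_right, real_inner_comm]
  linarith [sq_nonneg ‖α • R xdag‖]
end
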